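/- Let $G$ be a finite complex reflection group with $d_1 > d_2$ (so the highest degree is isolated). If a set of basic invariants $x$ is good with respect to one admissible triplet of $G$, then $x$ is good with respect to every admissible triplet of $G$. -/

import Mathlib

open MvPolynomial Matrix

noncomputable section

variable {n : ℕ}

/-- Pullback of polynomials along the linear map with matrix `M`:
`(pback M F)(v) = F (M *ᵥ v)`.  The pullback `g^*F` of the paper is `pback (g⁻¹).val F`. -/
def pback (M : Matrix (Fin n) (Fin n) ℂ) :
    MvPolynomial (Fin n) ℂ →ₐ[ℂ] MvPolynomial (Fin n) ℂ :=
  aeval fun i => ∑ j, C (M i j) * X j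

/-- Multi-index partial derivative `∂^a/∂z^a` of a polynomial (in the standard coordinates). -/
def mderiv (a : Fin n → ℕ) (F : MvPolynomial (Fin n) ℂ) : MvPolynomial (Fin n) ℂ :=
  (List.finRange n).foldr (fun i acc => (fun p => pderiv i p)^[a i] acc) F

/-- The linear coordinate `z^α = ∑_j P_{α j} u^j` of the coordinate system given by `P`. -/
def coordPoly (P : GL (Fin n) ℂ) (α : Fin n) : MvPolynomial (Fin n) ℂ :=
  ∑ j, C (P.val α j) * X j

/-- `∂^a F/∂z^a` evaluated at `q`, where `z = P u` are the coordinates given by `P`. -/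
def zderivAt (P : GL (Fin n) ℂ) (a : Fin n → ℕ) (F : MvPolynomial (Fin n) ℂ)
    (q : Fin n → ℂ) : ℂ :=
  eval (P.val *ᵥ q) (mderiv a (pback (P⁻¹).val F))

/-- `g` is a (complex) reflection: it fixes a hyperplane pointwise and is not the identity. -/
def IsReflection (g : GL (Fin n) ℂ) : Prop :=
  g ≠ 1 ∧
    Module.finrank ℂ (LinearMap.range (Matrix.toLin' (g.val - 1))) = 1

/-- A finite complex reflection group: a finite subgroup generated by its reflections. -/
def IsReflectionGroup (G : Subgroup (GL (Fin n) ℂ)) : Prop :=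
  Finite G ∧ Subgroup.closure {g | g ∈ G ∧ IsReflection g} = G

/-- A regular vector: it lies on no reflection hyperplane of `G`. -/
def IsRegularVec (G : Subgroup (GL (Fin n) ℂ)) (q : Fin n → ℂ) : Prop :=
  q ≠ 0 ∧ ∀ g ∈ G, IsReflection g → g.val *ᵥ q ≠ q

/-- A `ζ`-regular element of `G`: its `ζ`-eigenspace contains a regular vector. -/
def IsZetaRegular (G : Subgroup (GL (Fin n) ℂ)) (g : GL (Fin n) ℂ) (ζ : ℂ) : Prop :=
  g ∈ G ∧ ∃ q, IsRegularVec G q ∧ g.val *ᵥ q = ζ • q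

/-- A set of basic invariants of `G` with degrees `d`. -/
structure BasicInvariants (G : Subgroup (GL (Fin n) ℂ)) (d : Fin n → ℕ)
    (x : Fin n → MvPolynomial (Fin n) ℂ) : Prop where
  pos : ∀ α, 0 < d α
  homog : ∀ α, (x α).IsHomogeneous (d α)
  invariant : ∀ g ∈ G, ∀ α, pback (g : GL (Fin n) ℂ).val (x α) = x α
  indep : AlgebraicIndependent ℂ x
  gen : ∀ F : MvPolynomial (Fin n) ℂ, (∀ g ∈ G, pback (g : GL (Fin n) ℂ).val F = F) →
    F ∈ Algebra.adjoin ℂ (Set.range x)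

/-- An admissible triplet `(g, ζ, q)`; the degrees are arranged so that `d 0` is the highest. -/
structure AdmissibleTriplet [NeZero n] (G : Subgroup (GL (Fin n) ℂ)) (d : Fin n → ℕ)
    (g : GL (Fin n) ℂ) (ζ : ℂ) (q : Fin n → ℂ) : Prop where
  prim : IsPrimitiveRoot ζ (d 0)
  reg : IsZetaRegular G g ζ
  regq : IsRegularVec G q
  eig : g.val *ᵥ q = ζ • q

/-- `P` gives a `(g,ζ)`-graded coordinate system: `g^* z^α = ζ^{d_α-1} z^α`. -/
def GradedCoords (g : GL (Fin n) ℂ) (ζ : ℂ) (d : Fin n → ℕ) (P : GL (Fin n) ℂ) : Prop :=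
  ∀ α, pback (g⁻¹).val (coordPoly P α) = C (ζ ^ ((d α : ℤ) - 1)) * coordPoly P α

/-- The multi-index `e_β`. -/
def unitIdx (β : Fin n) : Fin n → ℕ := fun j => if j = β then 1 else 0

/-- `x` is compatible with the coordinate system given by `P` at `q`:
`∂x^α/∂z^β (q) = δ^α_β`. -/
def Compatible (P : GL (Fin n) ℂ) (q : Fin n → ℂ)
    (x : Fin n → MvPolynomial (Fin n) ℂ) : Prop :=
  ∀ α β, zderivAt P (unitIdx β) (x α) q = if α = β then 1 else 0

/-- `x` is good: the derivatives `∂^a x^α/∂z^a` vanish at `q` for every `a ∈ I_α^{(0)}`. -/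
def IsGood [NeZero n] (P : GL (Fin n) ℂ) (q : Fin n → ℂ) (d : Fin n → ℕ)
    (x : Fin n → MvPolynomial (Fin n) ℂ) : Prop :=
  ∀ α (a : Fin n → ℕ), (∑ β, a β * d β) = d α → 2 ≤ ∑ β, a β →
    zderivAt P a (x α) q = 0

/-- Multi-index partial derivative of a function on `ℂ^n`. -/
def mpd (a : Fin n → ℕ) (f : (Fin n → ℂ) → ℂ) : (Fin n → ℂ) → ℂ :=
  (List.finRange n).foldr
    (fun i acc => (fun g v => fderiv ℂ g v (Pi.single i 1))^[a i] acc) f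

/-- `f` is a rational function which is regular at `q`. -/
def RegRat (q : Fin n → ℂ) (f : (Fin n → ℂ) → ℂ) : Prop :=
  ∃ p s : MvPolynomial (Fin n) ℂ, eval q s ≠ 0 ∧
    ∀ v, eval v s ≠ 0 → f v = eval v p / eval v s

/-- Condition `P(i)`: the value at `q` is diagonal and nonvanishing derivatives at `q`
satisfy `a·d + d_β = d_γ + k d_1` with `k ≥ i`. -/
def CondP [NeZero n] (d : Fin n → ℕ) (q : Fin n → ℂ) (i : ℕ)
    (M : Fin n → Fin n → (Fin n → ℂ) → ℂ) : Prop :=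
  (∀ γ β, γ ≠ β → M γ β q = 0) ∧
    ∀ γ β (a : Fin n → ℕ), a ≠ 0 → mpd a (M γ β) q ≠ 0 →
      ∃ k : ℕ, i ≤ k ∧ (∑ α, a α * d α) + d β = d γ + k * d 0

/-- Condition `Q(j,h)`: nonvanishing derivatives at `q` satisfy
`a·d + h + d_β = d_γ + k d_1` with `k ≥ j`. -/
def CondQ [NeZero n] (d : Fin n → ℕ) (q : Fin n → ℂ) (j h : ℕ)
    (M : Fin n → Fin n → (Fin n → ℂ) → ℂ) : Prop :=
  ∀ γ β (a : Fin n → ℕ), mpd a (M γ β) q ≠ 0 →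
    ∃ k : ℕ, j ≤ k ∧ (∑ α, a α * d α) + h + d β = d γ + k * d 0

/-- Entrywise product of matrices of functions. -/
def matMulF (Xm Ym : Fin n → Fin n → (Fin n → ℂ) → ℂ) :
    Fin n → Fin n → (Fin n → ℂ) → ℂ :=
  fun γ β v => ∑ ρ, Xm γ ρ v * Ym ρ β v

/-- The `(γ,β)` entry of the Jacobian matrix `J = (∂x^γ/∂z^β)`, expressed in the
coordinates `z = P u`, as a function on coordinate space. -/
def jacEntry (P : GL (Fin n) ℂ) (x : Fin n → MvPolynomial (Fin n) ℂ) (γ β : Fin n) :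
    (Fin n → ℂ) → ℂ :=
  fun v => eval v (pderiv β (pback (P⁻¹).val (x γ)))

/-! ### Pullbacks and directional derivatives -/

theorem eval_pback (M : Matrix (Fin n) (Fin n) ℂ) (F : MvPolynomial (Fin n) ℂ) (v : Fin n → ℂ) :
    eval v (pback M F) = eval (M *ᵥ v) F := by
  induction F using MvPolynomial.induction_on with
  | C a => simp [pback]
  | add p q hp hq => simp [hp, hq]
  | mul_X p i hp =>
    rw [map_mul, map_mul, map_mul, hp]
    congr 1
    simp [pback, Matrix.mulVec, dotProduct]

theorem pback_pback (A B : Matrix (Fin n) (Fin n) ℂ) (F : MvPolynomial (Fin n) ℂ) :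
    pback A (pback B F) = pback (B * A) F := by
  apply MvPolynomial.funext
  intro v
  simp [eval_pback, Matrix.mulVec_mulVec]

theorem pback_one (F : MvPolynomial (Fin n) ℂ) : pback 1 F = F := by
  apply MvPolynomial.funext
  intro v
  simp [eval_pback]

/-- Chain rule. -/
theorem pderiv_pback (M : Matrix (Fin n) (Fin n) ℂ) (F : MvPolynomial (Fin n) ℂ) (i : Fin n) :
    pderiv i (pback M F) = ∑ k, C (M k i) * pback M (pderiv k F) := by
  induction F using MvPolynomial.induction_on with
  | C a => simp [pback]
  | add p q hp hq => simp [hp, hq, mul_add, Finset.sum_add_distrib]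
  | mul_X p j hp =>
    have hX : pderiv i (pback M (X j)) = C (M j i) := by
      simp [pback, pderiv_X, Pi.single_apply]
    have hX2 : ∀ k, pback M (pderiv k (p * X j)) =
        pback M (pderiv k p) * pback M (X j) + pback M p * (if k = j then 1 else 0) := by
      intro k
      rw [pderiv_mul, map_add, map_mul, map_mul, pderiv_X]
      congr 2
      by_cases h : k = j
      · subst h; simp
      · simp [h, Ne.symm h]
    rw [map_mul, pderiv_mul, hp, hX]
    simp only [hX2, mul_add, Finset.sum_add_distrib, Finset.sum_mul]
    congr 1
    · exact Finset.sum_congr rfl fun k _ => by ring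
    · simp [mul_comm]

/-- Directional derivative of `F` at `p` in direction `u`. -/
def ddir (p u : Fin n → ℂ) (F : MvPolynomial (Fin n) ℂ) : ℂ :=
  ∑ j, u j * eval p (pderiv j F)

theorem ddir_add (p u : Fin n → ℂ) (F H : MvPolynomial (Fin n) ℂ) :
    ddir p u (F + H) = ddir p u F + ddir p u H := by
  simp [ddir, mul_add, Finset.sum_add_distrib]

theorem ddir_mul (p u : Fin n → ℂ) (F H : MvPolynomial (Fin n) ℂ) :
    ddir p u (F * H) = ddir p u F * eval p H + eval p F * ddir p u H := by
  simp only [ddir, pderiv_mul, map_add, map_mul, Finset.sum_mul, Finset.mul_sum,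
    ← Finset.sum_add_distrib]
  exact Finset.sum_congr rfl fun k _ => by ring

theorem ddir_C (p u : Fin n → ℂ) (c : ℂ) : ddir p u (C c) = 0 := by
  simp [ddir]

theorem ddir_sum {ι : Type*} (s : Finset ι) (p u : Fin n → ℂ)
    (F : ι → MvPolynomial (Fin n) ℂ) :
    ddir p u (∑ i ∈ s, F i) = ∑ i ∈ s, ddir p u (F i) := by
  simp only [ddir, map_sum, Finset.mul_sum]
  exact Finset.sum_comm

theorem ddir_pback (M : Matrix (Fin n) (Fin n) ℂ) (p u : Fin n → ℂ)
    (F : MvPolynomial (Fin n) ℂ) :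
    ddir p u (pback M F) = ddir (M *ᵥ p) (M *ᵥ u) F := by
  simp only [ddir, pderiv_pback, map_sum, map_mul, eval_C, eval_pback, Matrix.mulVec, dotProduct,
    Finset.mul_sum, Finset.sum_mul]
  rw [Finset.sum_comm]
  exact Finset.sum_congr rfl fun k _ => Finset.sum_congr rfl fun j _ => by ring

theorem exists_sep (p w : Fin n → ℂ) (h : w ≠ p) :
    ∃ m : MvPolynomial (Fin n) ℂ, eval w m = 0 ∧ eval p m = 1 := by
  obtain ⟨i, hi⟩ := Function.ne_iff.mp h
  refine ⟨C ((p i - w i)⁻¹) * (X i - C (w i)), by simp, ?_⟩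
  have : p i - w i ≠ 0 := sub_ne_zero.mpr (Ne.symm hi)
  simp [this]

/-- Jacobian matrix. -/
def jmat (x : Fin n → MvPolynomial (Fin n) ℂ) :
    Matrix (Fin n) (Fin n) (MvPolynomial (Fin n) ℂ) :=
  Matrix.of fun α j => pderiv j (x α)

theorem eval_det_jmat (x : Fin n → MvPolynomial (Fin n) ℂ) (v : Fin n → ℂ) :
    eval v (jmat x).det = (Matrix.of fun α j => eval v (pderiv j (x α))).det := by
  rw [RingHom.map_det]
  rfl

theorem jmat_mulVec (x : Fin n → MvPolynomial (Fin n) ℂ) (v u : Fin n → ℂ) (α : Fin n) :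
    ((Matrix.of fun α j => eval v (pderiv j (x α))) *ᵥ u) α = ddir v u (x α) := by
  simp [Matrix.mulVec, dotProduct, ddir, mul_comm]

/-- Invariants only depend on the values of the basic invariants. -/
theorem eval_eq_of_inv {G : Subgroup (GL (Fin n) ℂ)} {d : Fin n → ℕ}
    {x : Fin n → MvPolynomial (Fin n) ℂ} (hx : BasicInvariants G d x)
    (p p' : Fin n → ℂ) (h : ∀ α, eval p (x α) = eval p' (x α))
    (F : MvPolynomial (Fin n) ℂ)
    (hF : ∀ g ∈ G, pback (g : GL (Fin n) ℂ).val F = F) : eval p F = eval p' F := by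
  have key : ∀ F ∈ Algebra.adjoin ℂ (Set.range x), eval p F = eval p' F := by
    intro F hF
    induction hF using Algebra.adjoin_induction with
    | mem y hy => obtain ⟨α, rfl⟩ := hy; exact h α
    | algebraMap r => simp [MvPolynomial.algebraMap_eq]
    | add a b _ _ ha hb => simp [ha, hb]
    | mul a b _ _ ha hb => simp [ha, hb]
  exact key F (hx.gen F hF)

theorem ddir_eq_zero_of_inv {G : Subgroup (GL (Fin n) ℂ)} {d : Fin n → ℕ}
    {x : Fin n → MvPolynomial (Fin n) ℂ} (hx : BasicInvariants G d x)
    (p u : Fin n → ℂ) (h : ∀ α, ddir p u (x α) = 0)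
    (F : MvPolynomial (Fin n) ℂ)
    (hF : ∀ g ∈ G, pback (g : GL (Fin n) ℂ).val F = F) : ddir p u F = 0 := by
  have key : ∀ F ∈ Algebra.adjoin ℂ (Set.range x), ddir p u F = 0 := by
    intro F hF
    induction hF using Algebra.adjoin_induction with
    | mem y hy => obtain ⟨α, rfl⟩ := hy; exact h α
    | algebraMap r => simp [MvPolynomial.algebraMap_eq, ddir_C]
    | add a b _ _ ha hb => simp [ddir_add, ha, hb]
    | mul a b _ _ ha hb => simp [ddir_mul, ha, hb]
  exact key F (hx.gen F hF)

/-- Basic invariants separate orbits. -/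
theorem orbit_of_eval_eq {G : Subgroup (GL (Fin n) ℂ)} [Finite G] {d : Fin n → ℕ}
    {x : Fin n → MvPolynomial (Fin n) ℂ} (hx : BasicInvariants G d x)
    (p p' : Fin n → ℂ) (h : ∀ α, eval p (x α) = eval p' (x α)) :
    ∃ g ∈ G, (g : GL (Fin n) ℂ).val *ᵥ p' = p := by
  by_contra hcon
  push Not at hcon
  have := Fintype.ofFinite G
  choose m hm0 hm1 using fun g : G => exists_sep p (g.1.val *ᵥ p') (hcon g.1 g.2)
  let f : MvPolynomial (Fin n) ℂ := 1 - ∏ g : G, m g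
  have hfp : eval p f = 0 := by simp [f, map_prod, hm1]
  have hfp' : ∀ g : G, eval (g.1.val *ᵥ p') f = 1 := by
    intro g
    have : ∏ g' : G, eval (g.1.val *ᵥ p') (m g') = 0 :=
      Finset.prod_eq_zero (Finset.mem_univ g) (hm0 g)
    simp [f, map_prod, this]
  let F : MvPolynomial (Fin n) ℂ := ∏ g : G, pback g.1.val f
  have hF : ∀ g ∈ G, pback (g : GL (Fin n) ℂ).val F = F := by
    intro k hk
    simp only [F, map_prod, pback_pback]
    exact Fintype.prod_equiv (Equiv.mulRight (⟨k, hk⟩ : G)) _ _ fun g => by simp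
  have h1 := eval_eq_of_inv hx p p' h F hF
  have h2 : eval p F = 0 := by
    simp only [F, map_prod, eval_pback]
    exact Finset.prod_eq_zero (Finset.mem_univ (1 : G)) (by simpa using hfp)
  have h3 : eval p' F = 1 := by
    simp [F, map_prod, eval_pback, hfp']
  rw [h2, h3] at h1
  exact zero_ne_one h1

/-- The Jacobian does not vanish at points with trivial stabilizer. -/
theorem jac_ne_zero_of_free {G : Subgroup (GL (Fin n) ℂ)} [Finite G] {d : Fin n → ℕ}
    {x : Fin n → MvPolynomial (Fin n) ℂ} (hx : BasicInvariants G d x)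
    (v : Fin n → ℂ) (hv : ∀ g ∈ G, (g : GL (Fin n) ℂ).val *ᵥ v = v → g = 1) :
    eval v (jmat x).det ≠ 0 := by
  classical
  rw [eval_det_jmat]
  intro hdet
  obtain ⟨u, hu0, hu⟩ := Matrix.exists_mulVec_eq_zero_iff.mpr hdet
  have hu' : ∀ α, ddir v u (x α) = 0 := fun α => by
    rw [← jmat_mulVec, hu]; rfl
  obtain ⟨i, hi⟩ := Function.ne_iff.mp hu0
  have := Fintype.ofFinite G
  have hsep : ∀ g : G, ∃ m : MvPolynomial (Fin n) ℂ, eval v m = 1 ∧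
      (g ≠ 1 → eval (g.1.val *ᵥ v) m = 0) := by
    intro g
    by_cases hg : g = 1
    · exact ⟨1, by simp, fun h => absurd hg h⟩
    · obtain ⟨m, h0, h1⟩ := exists_sep v (g.1.val *ᵥ v)
        (fun h => hg (Subtype.ext (hv g.1 g.2 h)))
      exact ⟨m, h1, fun _ => h0⟩
  choose m hm1 hm0 using hsep
  let r : MvPolynomial (Fin n) ℂ := ∏ g : G, m g
  let f : MvPolynomial (Fin n) ℂ := (X i - C (v i)) * (r * r)
  have hrv : eval v r = 1 := by simp [r, map_prod, hm1]
  have hrg : ∀ g : G, g ≠ 1 → eval (g.1.val *ᵥ v) r = 0 := by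
    intro g hg
    simp only [r, map_prod]
    exact Finset.prod_eq_zero (Finset.mem_univ g) (hm0 g hg)
  have hX : ddir v u (X i - C (v i)) = u i := by
    simp [ddir, pderiv_X, Pi.single_apply]
  have hf1 : ddir v u f = u i := by
    simp only [f, ddir_mul, hX, map_mul, hrv]
    simp
  have hf0 : ∀ g : G, g ≠ 1 → ∀ w, ddir (g.1.val *ᵥ v) w f = 0 := by
    intro g hg w
    simp only [f, ddir_mul, map_mul, hrg g hg]
    simp
  let F : MvPolynomial (Fin n) ℂ := ∑ g : G, pback g.1.val f
  have hF : ∀ g ∈ G, pback (g : GL (Fin n) ℂ).val F = F := by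
    intro k hk
    simp only [F, map_sum, pback_pback]
    exact Fintype.sum_equiv (Equiv.mulRight (⟨k, hk⟩ : G)) _ _ fun g => by simp
  have h1 := ddir_eq_zero_of_inv hx v u hu' F hF
  have h2 : ddir v u F = u i := by
    simp only [F, ddir_sum, ddir_pback]
    rw [Finset.sum_eq_single (1 : G)]
    · simpa using hf1
    · intro g _ hg; exact hf0 g hg _
    · simp
  exact hi (by rw [← h2, h1]; rfl)

/-- If the Jacobian does not vanish at `q`, the stabilizer of `q` is trivial. -/
theorem stab_trivial {G : Subgroup (GL (Fin n) ℂ)} {d : Fin n → ℕ}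
    {x : Fin n → MvPolynomial (Fin n) ℂ} (hx : BasicInvariants G d x)
    (q : Fin n → ℂ) (hq : eval q (jmat x).det ≠ 0) (g : GL (Fin n) ℂ) (hg : g ∈ G)
    (hgq : g.val *ᵥ q = q) : g = 1 := by
  rw [eval_det_jmat] at hq
  have key : ∀ u, g.val *ᵥ u = u := by
    intro u
    have hinj := Matrix.mulVec_injective_iff_isUnit.mpr
      ((Matrix.isUnit_iff_isUnit_det _).mpr (isUnit_iff_ne_zero.mpr hq))
    apply hinj
    ext α
    rw [jmat_mulVec, jmat_mulVec]
    conv_rhs => rw [← hx.invariant g hg α, ddir_pback, hgq]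
  apply Units.ext
  apply Matrix.toLin'.injective
  ext1 u
  ext1
  simp [key]

/-- Linear form. -/
def linF (w : Fin n → ℂ) : MvPolynomial (Fin n) ℂ := ∑ j, C (w j) * X j

theorem eval_linF (w v : Fin n → ℂ) : eval v (linF w) = w ⬝ᵥ v := by
  simp [linF, dotProduct]

theorem totalDegree_linF (w : Fin n → ℂ) : (linF w).totalDegree ≤ 1 := by
  refine (totalDegree_finsetSum _ _).trans (Finset.sup_le fun j _ => ?_)
  refine (totalDegree_mul _ _).trans ?_
  simp

theorem exists_not_dvd {G : Subgroup (GL (Fin n) ℂ)} (q : Fin n → ℂ) (hq : IsRegularVec G q)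
    (f : MvPolynomial (Fin n) ℂ) (hf0 : f ≠ 0) (hfq : eval q f = 0)
    (g : GL (Fin n) ℂ) (hg : g ∈ G) (hg1 : g ≠ 1) :
    ∃ i, ¬ f ∣ linF ((g.val - 1) i) := by
  by_contra hcon
  push Not at hcon
  have hfix : g.val *ᵥ q = q := by
    have : (g.val - 1) *ᵥ q = 0 := by
      ext i
      obtain ⟨c, hc⟩ := hcon i
      have := congrArg (eval q) hc
      rw [eval_linF, map_mul, hfq, zero_mul] at this
      exact this
    rwa [Matrix.sub_mulVec, Matrix.one_mulVec, sub_eq_zero] at this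
  have hdeg : f.totalDegree ≠ 0 := by
    intro h
    rw [totalDegree_eq_zero_iff_eq_C] at h
    rw [h, eval_C] at hfq
    rw [hfq] at h
    exact hf0 (by simpa using h)
  have hc : ∀ i, ∃ c : ℂ, linF ((g.val - 1) i) = f * C c := by
    intro i
    obtain ⟨c, hc⟩ := hcon i
    by_cases hc0 : c = 0
    · exact ⟨0, by simp [hc, hc0]⟩
    · have h1 := totalDegree_mul_of_isDomain hf0 hc0
      rw [← hc] at h1
      have h2 := totalDegree_linF ((g.val - 1) i)
      have h3 : c.totalDegree = 0 := by omega
      rw [totalDegree_eq_zero_iff_eq_C] at h3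
      exact ⟨_, by rw [hc, ← h3]⟩
  choose c hc using hc
  have hrange : LinearMap.range (Matrix.toLin' (g.val - 1)) ≤ Submodule.span ℂ {c} := by
    rintro _ ⟨v, rfl⟩
    rw [Submodule.mem_span_singleton]
    refine ⟨eval v f, ?_⟩
    ext i
    have := congrArg (eval v) (hc i)
    rw [eval_linF, map_mul, eval_C] at this
    rw [Matrix.toLin'_apply]
    exact this.symm
  have hle : Module.finrank ℂ (LinearMap.range (Matrix.toLin' (g.val - 1))) ≤ 1 :=
    (Submodule.finrank_mono hrange).trans (finrank_span_le_card _ |>.trans (by simp))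
  have hne : Module.finrank ℂ (LinearMap.range (Matrix.toLin' (g.val - 1))) ≠ 0 := by
    intro h
    rw [Submodule.finrank_eq_zero, LinearMap.range_eq_bot] at h
    apply hg1
    apply Units.ext
    have : g.val - 1 = 0 := Matrix.toLin'.injective (by rw [h, map_zero])
    rw [sub_eq_zero.mp this]; rfl
  exact hq.2 g hg ⟨hg1, by omega⟩ hfix

/-- The Jacobian does not vanish at regular vectors. -/
theorem jac_ne_zero_of_regular {G : Subgroup (GL (Fin n) ℂ)} [Finite G] {d : Fin n → ℕ}
    {x : Fin n → MvPolynomial (Fin n) ℂ} (hx : BasicInvariants G d x)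
    (q : Fin n → ℂ) (hq : IsRegularVec G q) : eval q (jmat x).det ≠ 0 := by
  classical
  have := Fintype.ofFinite G
  have zero_of : ∀ i : G → Fin n, ∀ v, eval v (jmat x).det = 0 →
      eval v (∏ g : G, if g = 1 then 1 else linF ((g.1.val - 1) (i g))) = 0 := by
    intro i v hv
    have : ∃ g ∈ G, (g : GL (Fin n) ℂ).val *ᵥ v = v ∧ g ≠ 1 := by
      by_contra hcon
      push Not at hcon
      exact jac_ne_zero_of_free hx v hcon hv
    obtain ⟨g, hg, hgv, hg1⟩ := this
    rw [map_prod]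
    apply Finset.prod_eq_zero (Finset.mem_univ (⟨g, hg⟩ : G))
    have : (⟨g, hg⟩ : G) ≠ 1 := fun h => hg1 (congrArg Subtype.val h)
    rw [if_neg this, eval_linF]
    have h2 : (g.val - 1) *ᵥ v = 0 := by
      rw [Matrix.sub_mulVec, Matrix.one_mulVec, hgv, sub_self]
    exact congrFun h2 _
  have hJ : (jmat x).det ≠ 0 := by
    intro hJ0
    have hrow : ∀ g : G, ∃ i : Fin n, g ≠ 1 → linF ((g.1.val - 1) i) ≠ 0 := by
      intro g
      by_cases hg : g = 1
      · obtain ⟨i, _⟩ := Function.ne_iff.mp hq.1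
        exact ⟨i, fun h => absurd hg h⟩
      · obtain ⟨j, _⟩ := Function.ne_iff.mp hq.1
        obtain ⟨i, hi⟩ := exists_not_dvd q hq (X j - C (q j)) (by
            intro h
            have := congrArg (eval (q + 1)) h
            simp at this) (by simp) g.1 g.2 (fun h => hg (Subtype.ext h))
        exact ⟨i, fun _ h => hi (by rw [h]; exact dvd_zero _)⟩
    choose i hi using hrow
    have hz : (∏ g : G, if g = 1 then 1 else linF ((g.1.val - 1) (i g))) = 0 := by
      apply MvPolynomial.funext
      intro v
      rw [zero_of i v (by rw [hJ0, map_zero]), map_zero]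
    rw [Finset.prod_eq_zero_iff] at hz
    obtain ⟨g, _, hg⟩ := hz
    by_cases h : g = 1
    · simp [h] at hg
    · rw [if_neg h] at hg; exact hi g h hg
  intro hq0
  obtain ⟨f, hfirr, hfdvd, hfq⟩ : ∃ f, Irreducible f ∧ f ∣ (jmat x).det ∧ eval q f = 0 := by
    obtain ⟨s, hs, hsa⟩ := WfDvdMonoid.exists_factors _ hJ
    obtain ⟨w, hw⟩ := hsa
    have h1 := hq0
    rw [← hw, map_mul, mul_eq_zero] at h1
    have h2 : eval q s.prod = 0 := h1.resolve_right (w.isUnit.map (eval q)).ne_zero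
    rw [map_multiset_prod, Multiset.prod_eq_zero_iff, Multiset.mem_map] at h2
    obtain ⟨f, hf, hfq⟩ := h2
    exact ⟨f, hs f hf, (Multiset.dvd_prod hf).trans ⟨_, hw.symm⟩, hfq⟩
  have hrow : ∀ g : G, ∃ i : Fin n, g ≠ 1 → ¬ f ∣ linF ((g.1.val - 1) i) := by
    intro g
    by_cases hg : g = 1
    · obtain ⟨i, _⟩ := Function.ne_iff.mp hq.1
      exact ⟨i, fun h => absurd hg h⟩
    · obtain ⟨i, hi⟩ := exists_not_dvd q hq f hfirr.ne_zero hfq g.1 g.2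
        (fun h => hg (Subtype.ext h))
      exact ⟨i, fun _ => hi⟩
  choose i hi using hrow
  have hrad : (∏ g : G, if g = 1 then 1 else linF ((g.1.val - 1) (i g))) ∈
      (Ideal.span {f}).radical := by
    rw [← MvPolynomial.vanishingIdeal_zeroLocus_eq_radical (K := ℂ), mem_vanishingIdeal_iff]
    intro v hv
    rw [mem_zeroLocus_iff] at hv
    have h1 := hv f (Ideal.mem_span_singleton_self f)
    obtain ⟨c, hc⟩ := hfdvd
    rw [aeval_eq_eval] at h1 ⊢
    exact zero_of i v (by rw [hc, map_mul]; exact mul_eq_zero_of_left h1 _)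
  obtain ⟨k, hk⟩ := hrad
  rw [Ideal.mem_span_singleton] at hk
  have h1 := hfirr.prime.dvd_of_dvd_pow hk
  rw [hfirr.prime.dvd_finsetProd_iff] at h1
  obtain ⟨g, _, hg⟩ := h1
  by_cases h : g = 1
  · rw [if_pos h] at hg
    exact hfirr.not_isUnit (isUnit_of_dvd_one hg)
  · rw [if_neg h] at hg; exact hi g h hg

/-! ### Iterated derivatives -/

theorem pderiv_comm' (i j : Fin n) (F : MvPolynomial (Fin n) ℂ) :
    pderiv i (pderiv j F) = pderiv j (pderiv i F) := by
  have h : ⁅pderiv (R := ℂ) i, pderiv (R := ℂ) j⁆ = 0 := by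
    apply MvPolynomial.derivation_ext
    intro k
    rw [Derivation.commutator_apply, pderiv_X, pderiv_X]
    by_cases h1 : i = k <;> by_cases h2 : j = k <;> simp [h1, h2]
  have h2 := congrArg (fun D => D F) h
  simp only [Derivation.commutator_apply, Derivation.coe_zero, Pi.zero_apply] at h2
  exact sub_eq_zero.mp h2

/-- Iterated partial derivative along a list of indices. -/
def dlist : List (Fin n) → MvPolynomial (Fin n) ℂ → MvPolynomial (Fin n) ℂ
  | [], F => F
  | i :: l, F => dlist l (pderiv i F)

theorem dlist_append (l l' : List (Fin n)) (F : MvPolynomial (Fin n) ℂ) :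
    dlist (l ++ l') F = dlist l' (dlist l F) := by
  induction l generalizing F with
  | nil => rfl
  | cons k l ih => simp only [dlist, List.cons_append]; rw [ih]

theorem dlist_perm {l l' : List (Fin n)} (h : l.Perm l') (F : MvPolynomial (Fin n) ℂ) :
    dlist l F = dlist l' F := by
  induction h generalizing F with
  | nil => rfl
  | cons x _ ih => simp only [dlist]; rw [ih]
  | swap x y l => simp only [dlist]; rw [pderiv_comm']
  | trans _ _ h1 h2 => rw [h1, h2]

theorem dlist_sum {ι : Type*} (s : Finset ι) (l : List (Fin n))
    (F : ι → MvPolynomial (Fin n) ℂ) :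
    dlist l (∑ i ∈ s, F i) = ∑ i ∈ s, dlist l (F i) := by
  induction l generalizing F with
  | nil => rfl
  | cons k l ih => simp only [dlist, map_sum]; rw [ih]

theorem dlist_C_mul (l : List (Fin n)) (c : ℂ) (F : MvPolynomial (Fin n) ℂ) :
    dlist l (C c * F) = C c * dlist l F := by
  induction l generalizing F with
  | nil => rfl
  | cons k l ih => simp only [dlist, pderiv_C_mul]; rw [ih]

theorem iterate_eq_dlist (k : ℕ) (i : Fin n) (F : MvPolynomial (Fin n) ℂ) :
    (fun p => pderiv i p)^[k] F = dlist (List.replicate k i) F := by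
  induction k generalizing F with
  | zero => rfl
  | succ k ih => rw [Function.iterate_succ_apply, ih]; rfl

/-- The list of indices of a multi-index. -/
def idxList (a : Fin n → ℕ) (L : List (Fin n)) : List (Fin n) :=
  L.flatMap fun i => List.replicate (a i) i

theorem mderiv_eq_dlist (a : Fin n → ℕ) (F : MvPolynomial (Fin n) ℂ) :
    mderiv a F = dlist (idxList a (List.finRange n)) F := by
  unfold mderiv
  induction List.finRange n with
  | nil => rfl
  | cons i L ih =>
    rw [List.foldr_cons, ih, iterate_eq_dlist, ← dlist_append]
    apply dlist_perm
    rw [idxList, idxList, List.flatMap_cons]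
    exact List.perm_append_comm

theorem count_idxList (a : Fin n → ℕ) (i : Fin n) :
    (idxList a (List.finRange n)).count i = a i := by
  rw [idxList, List.count_flatMap]
  have : (List.count i ∘ fun i => List.replicate (a i) i) = fun j => if j = i then a j else 0 := by
    ext j
    simp [List.count_replicate]
  rw [this, ← List.ofFn_eq_map, List.sum_ofFn]
  simp

theorem dlist_eq_mderiv (l : List (Fin n)) (F : MvPolynomial (Fin n) ℂ) :
    dlist l F = mderiv (fun i => l.count i) F := by
  rw [mderiv_eq_dlist]
  apply dlist_perm
  rw [List.perm_iff_count]
  intro i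
  rw [count_idxList]

theorem sum_count (l : List (Fin n)) (d : Fin n → ℕ) :
    ∑ β, l.count β * d β = (l.map d).sum := by
  induction l with
  | nil => simp
  | cons i l ih =>
    simp [List.count_cons, add_mul, Finset.sum_add_distrib, ih, add_comm]

theorem sum_count' (l : List (Fin n)) : ∑ β, l.count β = l.length := by
  have := sum_count l (fun _ => 1)
  simpa using this

theorem dlist_chain (M : Matrix (Fin n) (Fin n) ℂ) (d : Fin n → ℕ)
    (hM : ∀ k i, M k i ≠ 0 → d k = d i) (v : Fin n → ℂ) (l : List (Fin n)) :
    ∀ F : MvPolynomial (Fin n) ℂ,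
      (∀ l' : List (Fin n), l'.map d = l.map d → eval (M *ᵥ v) (dlist l' F) = 0) →
      eval v (dlist l (pback M F)) = 0 := by
  induction l with
  | nil =>
    intro F h
    simpa [dlist, eval_pback] using h [] rfl
  | cons i l ih =>
    intro F h
    simp only [dlist, pderiv_pback, dlist_sum, dlist_C_mul, map_sum, map_mul, eval_C]
    apply Finset.sum_eq_zero
    intro k _
    by_cases hk : M k i = 0
    · simp [hk]
    · rw [ih (pderiv k F), mul_zero]
      intro l' hl'
      have := h (k :: l') (by simp [hl', hM k i hk])
      simpa [dlist] using this

theorem good_chain (M : Matrix (Fin n) (Fin n) ℂ) (d : Fin n → ℕ)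
    (hM : ∀ k i, M k i ≠ 0 → d k = d i) (v : Fin n → ℂ) (F : MvPolynomial (Fin n) ℂ) (N : ℕ)
    (h : ∀ a : Fin n → ℕ, (∑ β, a β * d β) = N → 2 ≤ ∑ β, a β →
      eval (M *ᵥ v) (mderiv a F) = 0)
    (a : Fin n → ℕ) (ha : (∑ β, a β * d β) = N) (ha2 : 2 ≤ ∑ β, a β) :
    eval v (mderiv a (pback M F)) = 0 := by
  rw [mderiv_eq_dlist]
  set l := idxList a (List.finRange n) with hl
  have hc : ∀ β, a β = l.count β := fun β => (count_idxList a β).symm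
  simp only [hc] at ha ha2
  rw [sum_count] at ha
  rw [sum_count'] at ha2
  apply dlist_chain M d hM
  intro l' hl'
  rw [dlist_eq_mderiv]
  apply h
  · rw [sum_count, hl', ha]
  · rw [sum_count']
    have := congrArg List.length hl'
    simp only [List.length_map] at this
    omega

theorem eval_smul_homog {F : MvPolynomial (Fin n) ℂ} {N : ℕ} (hF : F.IsHomogeneous N)
    (c : ℂ) (v : Fin n → ℂ) : eval (c • v) F = c ^ N * eval v F := by
  rw [eval_eq', eval_eq', Finset.mul_sum]
  apply Finset.sum_congr rfl
  intro m hm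
  have h1 := hF (mem_support_iff.mp hm)
  have h2 : ∑ i, m i = N := by
    rw [← h1, Finsupp.weight_apply, Finsupp.sum_fintype]
    · simp
    · simp
  simp only [Pi.smul_apply, smul_eq_mul, mul_pow, Finset.prod_mul_distrib]
  rw [Finset.prod_pow_eq_pow_sum, h2]
  ring

theorem graded_matrix {g : GL (Fin n) ℂ} {ζ : ℂ} {d : Fin n → ℕ} {P : GL (Fin n) ℂ}
    (h : GradedCoords g ζ d P) :
    (P * g⁻¹ * P⁻¹).val = Matrix.diagonal fun α => ζ ^ ((d α : ℤ) - 1) := by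
  have h1 : P.val * (g⁻¹).val = (Matrix.diagonal fun α => ζ ^ ((d α : ℤ) - 1)) * P.val := by
    apply Matrix.toLin'.injective
    apply LinearMap.ext
    intro v
    ext α
    have h2 := congrArg (eval v) (h α)
    have h3 : ∀ w, eval w (coordPoly P α) = (P.val *ᵥ w) α := by
      intro w; simp [coordPoly, Matrix.mulVec, dotProduct]
    rw [eval_pback, map_mul, eval_C, h3, h3] at h2
    rw [Matrix.toLin'_apply, Matrix.toLin'_apply, ← Matrix.mulVec_mulVec, h2,
      ← Matrix.mulVec_mulVec, Matrix.mulVec_diagonal]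
  rw [Units.val_mul, Units.val_mul, h1, Matrix.mul_assoc, ← Units.val_mul, mul_inv_cancel,
    Units.val_one, Matrix.mul_one]

theorem eval_zero_of_regular [NeZero n] {G : Subgroup (GL (Fin n) ℂ)} {d : Fin n → ℕ}
    (hiso : ∀ α : Fin n, α ≠ 0 → d α < d 0)
    {x : Fin n → MvPolynomial (Fin n) ℂ} (hx : BasicInvariants G d x)
    {g : GL (Fin n) ℂ} {ζ : ℂ} {q : Fin n → ℂ} (h : AdmissibleTriplet G d g ζ q)
    (α : Fin n) (hα : α ≠ 0) : eval q (x α) = 0 := by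
  have h1 : eval q (x α) = ζ ^ d α * eval q (x α) := by
    conv_lhs => rw [← hx.invariant g h.reg.1 α, eval_pback, h.eig, eval_smul_homog (hx.homog α)]
  have h2 := h.prim.pow_ne_one_of_pos_of_lt (hx.pos α).ne' (hiso α hα)
  by_contra h3
  exact h2 (mul_right_cancel₀ h3 (by rw [one_mul]; exact h1.symm))

theorem eval_zero_ne_zero [NeZero n] {G : Subgroup (GL (Fin n) ℂ)} [Finite G] {d : Fin n → ℕ}
    (hiso : ∀ α : Fin n, α ≠ 0 → d α < d 0)
    {x : Fin n → MvPolynomial (Fin n) ℂ} (hx : BasicInvariants G d x)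
    {g : GL (Fin n) ℂ} {ζ : ℂ} {q : Fin n → ℂ} (h : AdmissibleTriplet G d g ζ q) :
    eval q (x 0) ≠ 0 := by
  intro h0
  obtain ⟨k, _, hk⟩ := orbit_of_eval_eq hx q 0 (by
    intro α
    have h1 : eval (0 : Fin n → ℂ) (x α) = 0 := by
      have := eval_smul_homog (hx.homog α) 0 0
      rw [zero_pow (hx.pos α).ne', zero_mul, smul_zero] at this
      exact this
    rw [h1]
    by_cases hα : α = 0
    · rw [hα, h0]
    · exact eval_zero_of_regular hiso hx h α hα)
  exact h.regq.1 (by rw [← hk, Matrix.mulVec_zero])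

theorem inv_val_mulVec (g : GL (Fin n) ℂ) (v w : Fin n → ℂ) (h : g.val *ᵥ v = w) :
    (g⁻¹).val *ᵥ w = v := by
  rw [← h, Matrix.mulVec_mulVec, ← Units.val_mul, inv_mul_cancel, Units.val_one,
    Matrix.one_mulVec]

theorem pow_mulVec (g : GL (Fin n) ℂ) (ζ : ℂ) (q : Fin n → ℂ) (h : g.val *ᵥ q = ζ • q) (j : ℕ) :
    (g ^ j).val *ᵥ q = ζ ^ j • q := by
  induction j with
  | zero => simp
  | succ j ih =>
    rw [pow_succ, Units.val_mul, ← Matrix.mulVec_mulVec, h, Matrix.mulVec_smul, ih, smul_smul,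
      pow_succ, mul_comm]

theorem stmt_10 [NeZero n] (G : Subgroup (GL (Fin n) ℂ)) (hG : IsReflectionGroup G)
    (d : Fin n → ℕ) (hd : Antitone d) (hiso : ∀ α : Fin n, α ≠ 0 → d α < d 0)
    (x : Fin n → MvPolynomial (Fin n) ℂ) (hx : BasicInvariants G d x)
    (hgood : ∃ (g : GL (Fin n) ℂ) (ζ : ℂ) (q : Fin n → ℂ) (P : GL (Fin n) ℂ),
      AdmissibleTriplet G d g ζ q ∧ GradedCoords g ζ d P ∧ IsGood P q d x) :
    ∀ (g : GL (Fin n) ℂ) (ζ : ℂ) (q : Fin n → ℂ) (P : GL (Fin n) ℂ),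
      AdmissibleTriplet G d g ζ q → GradedCoords g ζ d P → IsGood P q d x := by
  obtain ⟨g, ζ, q, P, hadm, hgr, hgood⟩ := hgood
  intro g' ζ' q' P' hadm' hgr'
  have : Finite G := hG.1
  have hx0 := eval_zero_ne_zero hiso hx hadm
  have hx0' := eval_zero_ne_zero hiso hx hadm'
  obtain ⟨c, hc⟩ := IsAlgClosed.exists_pow_nat_eq (eval q' (x 0) / eval q (x 0)) (hx.pos 0)
  have hc0 : c ≠ 0 := by
    rintro rfl
    rw [zero_pow (hx.pos 0).ne'] at hc
    exact div_ne_zero hx0' hx0 hc.symm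
  obtain ⟨h, hhG, hh⟩ := orbit_of_eval_eq hx q' (c • q) (by
    intro α
    rw [eval_smul_homog (hx.homog α)]
    by_cases hα : α = 0
    · rw [hα, hc, div_mul_cancel₀ _ hx0]
    · rw [eval_zero_of_regular hiso hx hadm α hα, eval_zero_of_regular hiso hx hadm' α hα,
        mul_zero])
  have : NeZero (d 0) := ⟨(hx.pos 0).ne'⟩
  obtain ⟨j, _, hj⟩ := hadm.prim.eq_pow_of_pow_eq_one hadm'.prim.pow_eq_one
  have hgh : g'.val *ᵥ (h.val *ᵥ q) = ζ' • (h.val *ᵥ q) := by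
    have h1 := hadm'.eig
    rw [← hh, Matrix.mulVec_smul, Matrix.mulVec_smul, smul_comm] at h1
    exact smul_right_injective _ hc0 h1
  have hconj : (g ^ j)⁻¹ * (h⁻¹ * (g' * h)) = 1 := by
    apply stab_trivial hx q (jac_ne_zero_of_regular hx q hadm.regq)
    · exact G.mul_mem (G.inv_mem (G.pow_mem hadm.reg.1 j))
        (G.mul_mem (G.inv_mem hhG) (G.mul_mem hadm'.reg.1 hhG))
    · rw [Units.val_mul, Units.val_mul, Units.val_mul, ← Matrix.mulVec_mulVec,
        ← Matrix.mulVec_mulVec, ← Matrix.mulVec_mulVec, hgh, Matrix.mulVec_smul,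
        inv_val_mulVec h q _ rfl]
      apply inv_val_mulVec
      rw [pow_mulVec g ζ q hadm.eig, hj]
  have hg' : g' = h * g ^ j * h⁻¹ := by
    rw [inv_mul_eq_one] at hconj
    rw [hconj]; group
  have hE' := graded_matrix hgr'
  have hE := graded_matrix hgr
  have hEE : P' * g'⁻¹ * P'⁻¹ = P * (g ^ j)⁻¹ * P⁻¹ := by
    have h1 : P * (g ^ j)⁻¹ * P⁻¹ = (P * g⁻¹ * P⁻¹) ^ j := by
      rw [conj_pow, inv_pow]
    rw [h1]
    apply Units.ext
    rw [Units.val_pow_eq_pow_val, hE', hE, Matrix.diagonal_pow]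
    congr 1
    ext α
    rw [Pi.pow_apply, ← hj, ← zpow_natCast, ← zpow_natCast, ← _root_.zpow_mul, ← _root_.zpow_mul, mul_comm]
  have hcomm : (P * h⁻¹ * P'⁻¹) * (P' * g'⁻¹ * P'⁻¹) = (P' * g'⁻¹ * P'⁻¹) * (P * h⁻¹ * P'⁻¹) := by
    conv_rhs => rw [hEE]
    rw [hg']; group
  set K : GL (Fin n) ℂ := P * h⁻¹ * P'⁻¹ with hK
  have hblock : ∀ k i, K.val k i ≠ 0 → d k = d i := by
    intro k i hki
    have h1 := congrArg Units.val hcomm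
    rw [Units.val_mul K, Units.val_mul _ K, hE'] at h1
    have h2 := congrFun (congrFun h1 k) i
    rw [Matrix.mul_diagonal, Matrix.diagonal_mul, mul_comm] at h2
    have h3 := mul_right_cancel₀ hki h2
    have h4 : ∀ α, ζ' ^ ((d α : ℤ) - 1) = ζ' ^ (d α - 1) := by
      intro α
      rw [← zpow_natCast, Nat.cast_sub (hx.pos α), Nat.cast_one]
    rw [h4, h4] at h3
    have hle : ∀ α, d α - 1 < d 0 := by
      intro α
      have h5 : d α ≤ d 0 := hd (Fin.zero_le _)
      have := hx.pos α
      omega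
    have h5 := hadm'.prim.pow_inj (hle i) (hle k) h3
    have := hx.pos i
    have := hx.pos k
    omega
  intro α a ha ha2
  unfold zderivAt
  have hv : (c⁻¹ • K.val) *ᵥ (P'.val *ᵥ q') = P.val *ᵥ q := by
    rw [← hh, Matrix.smul_mulVec, Matrix.mulVec_smul, Matrix.mulVec_smul, Matrix.mulVec_smul,
      smul_smul, inv_mul_cancel₀ hc0, one_smul, Matrix.mulVec_mulVec, Matrix.mulVec_mulVec,
      ← Units.val_mul, ← Units.val_mul]
    congr 2
    rw [hK]; group
  have hmain := good_chain (c⁻¹ • K.val) d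
    (fun k i hki => hblock k i fun h0 => hki (by simp [h0])) (P'.val *ᵥ q')
    (pback (P⁻¹).val (x α)) (d α)
    (by rw [hv]; exact fun b hb hb2 => hgood α b hb hb2) a ha ha2
  have hpb : pback (c⁻¹ • K.val) (pback (P⁻¹).val (x α)) =
      C (c⁻¹ ^ d α) * pback (P'⁻¹).val (x α) := by
    apply MvPolynomial.funext
    intro v
    rw [map_mul, eval_C]
    simp only [eval_pback]
    rw [Matrix.smul_mulVec, Matrix.mulVec_smul, eval_smul_homog (hx.homog α)]
    congr 1
    rw [Matrix.mulVec_mulVec, ← Units.val_mul]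
    have h1 : P⁻¹ * K = h⁻¹ * P'⁻¹ := by rw [hK]; group
    rw [h1, Units.val_mul, ← Matrix.mulVec_mulVec, ← eval_pback,
      hx.invariant h⁻¹ (G.inv_mem hhG) α]
  rw [hpb, mderiv_eq_dlist, dlist_C_mul, ← mderiv_eq_dlist, map_mul, eval_C] at hmain
  exact (mul_eq_zero.mp hmain).resolve_left (pow_ne_zero _ (inv_ne_zero hc0))

end
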